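/- arXiv:2306.02868 — 6 statements merged into one kernel-verified Lean document; each statement's English description precedes it below -/
import Mathlib

section
/- Let q ≥ 2 and m ≥ 1 be integers, let α ∈ Σ_q^m, and let a = φ_m(α) ∈ Σ_2^m. Suppose α' ∈ Σ_q^{m−1} is obtained from α by deleting exactly one entry, and let a' = φ_{m−1}(α') ∈ Σ_2^{m−1}. Then a' is a subsequence of a. -/
/-- `y` is a subsequence of `x` (obtained by deleting entries, order preserved). -/
def Subseq {q m n : ℕ} (y : Fin m → Fin q) (x : Fin n → Fin q) : Prop :=
  ∃ f : Fin m → Fin n, StrictMono f ∧ ∀ i, y i = x (f i)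

/-- The map φ sending a q-ary string to a binary string: a_1 = 1, and for i ≥ 2,
a_i = 1 iff α_i ≥ α_{i-1}. -/
def phi {q n : ℕ} (α : Fin n → Fin q) : Fin n → Fin 2 :=
  fun i => if _h : (i : ℕ) = 0 then 1
    else if α ⟨(i : ℕ) - 1, Nat.lt_of_le_of_lt (Nat.sub_le _ _) i.isLt⟩ ≤ α i then 1 else 0

/-- A strictly increasing map between finite ordinals expands distances. -/
lemma StrictMono.fin_val_add_le {m n : ℕ} {f : Fin m → Fin n} (hf : StrictMono f) (i : Fin m)
    (d : ℕ) (h : (i : ℕ) + d < m) : (f i : ℕ) + d ≤ f ⟨i + d, h⟩ := by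
  induction d with
  | zero => simp
  | succ d ih =>
    have h₁ := ih (by omega)
    have h₂ : f ⟨i + d, by omega⟩ < f ⟨i + (d + 1), h⟩ := hf (by simp [Fin.lt_def])
    rw [Fin.lt_def] at h₂
    omega

/-- A strictly increasing map `Fin n → Fin (n + 1)` moves each index by at most one. -/
lemma StrictMono.fin_eq_castSucc_or_eq_succ {n : ℕ} {f : Fin n → Fin (n + 1)} (hf : StrictMono f)
    (i : Fin n) : f i = i.castSucc ∨ f i = i.succ := by
  have h₁ := hf.fin_val_add_le ⟨0, i.pos⟩ i (by simp)
  have h₂ := hf.fin_val_add_le i (n - 1 - i) (by omega)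
  have h₃ := (f ⟨i + (n - 1 - i), by omega⟩).isLt
  simp only [zero_add, Fin.eta] at h₁
  simp only [Fin.ext_iff, Fin.val_castSucc, Fin.val_succ]
  omega

lemma phi_of_val_eq_zero {q n : ℕ} (α : Fin n → Fin q) {i : Fin n} (h : (i : ℕ) = 0) :
    phi α i = 1 := by
  simp [phi, h]

lemma phi_of_val_eq_succ {q n : ℕ} (α : Fin n → Fin q) {i j : Fin n} (h : (i : ℕ) = j + 1) :
    phi α i = if α j ≤ α i then 1 else 0 := by
  simp [phi, h]

/-- If α' is obtained from α ∈ Σ_q^m by deleting one entry, then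
φ_{m-1}(α') is a subsequence of φ_m(α). -/
theorem stmt0 (q m : ℕ) (hq : 2 ≤ q) (hm : 1 ≤ m)
    (α : Fin m → Fin q) (α' : Fin (m - 1) → Fin q)
    (h : Subseq α' α) :
    Subseq (phi α') (phi α) := by
  obtain ⟨n, rfl⟩ : ∃ n, m = n + 1 := ⟨m - 1, by omega⟩
  change Fin n → Fin q at α'
  obtain ⟨f, hf, hα⟩ := h
  change Fin n → Fin (n + 1) at f
  change ∀ i : Fin n, α' i = α (f i) at hα
  change StrictMono f at hf
  have hcases := hf.fin_eq_castSucc_or_eq_succ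
  -- Before the deleted position, and at it if the symbols agree, `phi` is copied in place.
  let P : Fin n → Prop := fun i =>
    (∀ j < i, f j = j.castSucc) ∧ phi α' i = phi α i.castSucc
  have hP : ∀ i j, i < j → P j → P i := by
    rintro i j hij ⟨hj, -⟩
    refine ⟨fun k hk => hj k (hk.trans hij), ?_⟩
    rcases Nat.eq_zero_or_pos i with hi | hi
    · rw [phi_of_val_eq_zero _ hi, phi_of_val_eq_zero _ (by simpa using hi)]
    · obtain ⟨k, hk⟩ : ∃ k : Fin n, (i : ℕ) = k + 1 := ⟨⟨i - 1, by omega⟩, by simp; omega⟩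
      have hki : k < i := by rw [Fin.lt_def]; omega
      rw [phi_of_val_eq_succ α' hk,
        phi_of_val_eq_succ α (i := i.castSucc) (j := k.castSucc) (by simpa using hk),
        hα, hα, hj i hij, hj k (hki.trans hij)]
  classical
  refine ⟨fun i : Fin n => if P i then i.castSucc else i.succ, ?_, ?_⟩
  · intro i j hij
    have hlt : (i : ℕ) < j := hij
    have := hP i j hij
    dsimp only
    split_ifs <;> first | tauto | (simp only [Fin.lt_def, Fin.val_succ]; omega)
  · intro i
    change Fin n at i
    change phi α' i = phi α (if P i then i.castSucc else i.succ)
    split_ifs with hi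
    · exact hi.2
    · rcases Nat.eq_zero_or_pos i with h0 | h0
      · refine absurd ⟨fun j hj => ?_, ?_⟩ hi
        · rw [Fin.lt_def] at hj
          omega
        · rw [phi_of_val_eq_zero _ h0, phi_of_val_eq_zero _ (by simpa using h0)]
      · obtain ⟨k, hk⟩ : ∃ k : Fin n, (i : ℕ) = k + 1 := ⟨⟨i - 1, by omega⟩, by simp; omega⟩
        have hki : k < i := by rw [Fin.lt_def]; omega
        have hks : k.succ = i.castSucc := by simp [Fin.ext_iff, hk]
        have e' := phi_of_val_eq_succ α' hk
        have e₀ := phi_of_val_eq_succ α (i := i.castSucc) (j := k.castSucc) (by simpa using hk)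
        have e₁ := phi_of_val_eq_succ α (i := i.succ) (j := i.castSucc) (by simp)
        rw [hα, hα] at e'
        rcases hcases k with hfk | hfk
        · have hlow : ∀ j < i, f j = j.castSucc := by
            intro j hj
            rcases eq_or_ne j k with rfl | hjk
            · exact hfk
            · have hjk' : j < k := by
                rw [Fin.lt_def] at hj ⊢
                have := Fin.val_ne_of_ne hjk
                omega
              refine (hcases j).resolve_right fun hs => ?_
              have := hf.fin_val_add_le j (k - j) (by omega)
              rw [Fin.lt_def] at hjk'
              have hkj : (⟨j + (k - j), by omega⟩ : Fin n) = k := by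
                simp [Fin.ext_iff]; omega
              rw [hkj, hs, hfk] at this
              simp at this
              omega
          have hne : phi α' i ≠ phi α i.castSucc := fun he => hi ⟨hlow, he⟩
          rcases hcases i with hfi | hfi
          · rw [hfk, hfi] at e'
            exact absurd (e'.trans e₀.symm) hne
          · rw [hfk, hfi] at e'
            rw [e', e₀] at hne
            rw [e', e₁]
            split_ifs at hne ⊢ <;> first | rfl | (exfalso; order)
        · have hfi : f i = i.succ := by
            refine (hcases i).resolve_left fun hs => ?_
            have := hf hki
            rw [hs, hfk, hks] at this
            exact this.false
          rw [e', e₁, hfk, hfi, hks]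
end

section
/- Let q ≥ 2 and 1 ≤ m < n be integers, let α ∈ Σ_q^n, and let a = φ_n(α). Suppose α' ∈ Σ_q^m is a subsequence of α obtained by deleting n−m entries, and let a' = φ_m(α'). Then a' is a subsequence of a. -/
/-- Between two positions of a sequence there is a consecutive step whose direction
(weak ascent or strict descent) agrees with the comparison of the two endpoints. -/
theorem exists_step_le_iff {β : Type*} [LinearOrder β] (u : ℕ → β) {a b : ℕ} (hab : a < b) :
    ∃ j, a < j ∧ j ≤ b ∧ (u (j - 1) ≤ u j ↔ u a ≤ u b) := by
  by_contra! hne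
  by_cases hle : u a ≤ u b
  · have key : ∀ k, a < k → k ≤ b → u k < u a := by
      intro k hk
      induction k, hk using Nat.le_induction with
      | base =>
        intro hb
        have hstep := hne (a + 1) (by omega) hb
        rw [Nat.add_sub_cancel] at hstep
        rcases hstep with hstep | hstep <;> order
      | succ k hk ih =>
        intro hb
        have hstep := hne (k + 1) (by omega) hb
        have hk := ih (by omega)
        rw [Nat.add_sub_cancel] at hstep
        rcases hstep with hstep | hstep <;> order
    exact absurd hle (not_le.2 (key b hab le_rfl))
  · have key : ∀ k, a ≤ k → k ≤ b → u a ≤ u k := by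
      intro k hk
      induction k, hk using Nat.le_induction with
      | base => intro _; exact le_rfl
      | succ k hk ih =>
        intro hb
        have hstep := hne (k + 1) (by omega) hb
        have hk := ih (by omega)
        rw [Nat.add_sub_cancel] at hstep
        rcases hstep with hstep | hstep <;> order
    exact hle (key b hab.le le_rfl)

/-- If α' ∈ Σ_q^m is a subsequence of α ∈ Σ_q^n (obtained by deleting
n−m entries), then φ_m(α') is a subsequence of φ_n(α). -/
theorem stmt1 (q m n : ℕ) (hq : 2 ≤ q) (hm : 1 ≤ m) (hmn : m < n)
    (α : Fin n → Fin q) (α' : Fin m → Fin q)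
    (h : Subseq α' α) :
    Subseq (phi α') (phi α) := by
  obtain ⟨f, hf, hα⟩ := h
  have hstep : ∀ i : Fin m, ∃ j : Fin n, j ≤ f i ∧ phi α' i = phi α j ∧
      ∀ k : Fin m, k < i → f k < j := by
    intro i
    by_cases hi : (i : ℕ) = 0
    · refine ⟨⟨0, by omega⟩, Nat.zero_le _, by simp [phi, hi], fun k hk => ?_⟩
      have : (k : ℕ) < i := hk
      omega
    · let p : Fin m := ⟨(i : ℕ) - 1, by omega⟩
      have hp : p < i := Fin.lt_def.2 (by simp only [p]; omega)
      let u : ℕ → Fin q := fun k => if hk : k < n then α ⟨k, hk⟩ else ⟨0, by omega⟩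
      obtain ⟨j, hj, hji, hiff⟩ := exists_step_le_iff u (Fin.lt_def.1 (hf hp))
      have hjn : j < n := by omega
      have hjn' : j - 1 < n := by omega
      refine ⟨⟨j, hjn⟩, hji, ?_, fun k hk => ?_⟩
      · have hj0 : j ≠ 0 := by omega
        simp only [u, hjn, hjn', Fin.is_lt, dite_true, Fin.eta, ← hα] at hiff
        simp only [phi, hi, hj0, dite_false, hiff, p]
      · have hkp : k ≤ p := Fin.le_def.2 (by have := Fin.lt_def.1 hk; simp only [p]; omega)
        exact lt_of_le_of_lt (hf.monotone hkp) (Fin.lt_def.2 hj)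
  choose g hgf hg hlt using hstep
  exact ⟨g, fun i k hik => (hgf i).trans_lt (hlt k i hik), hg⟩
end

section
/- Let q > 2 and m ≥ 3 be integers. Then F_m^(1) < F_m^(0) < (0.99·q)^m, where F_m^(0) is the number of strings in Σ_q^m containing no index i with α_i > α_{i+1} > α_{i+2}, and F_m^(1) is the number of strings in Σ_q^m containing no index i with α_i ≤ α_{i+1} ≤ α_{i+2}. -/
/-- F_m⁽⁰⁾: the number of q-ary strings of length m containing no index i with
α_i > α_{i+1} > α_{i+2}. -/
noncomputable def F0 (q m : ℕ) : ℕ :=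
  {α : Fin m → Fin q | ¬ ∃ i : ℕ, ∃ h : i + 2 < m,
    α ⟨i + 1, by omega⟩ < α ⟨i, by omega⟩ ∧ α ⟨i + 2, h⟩ < α ⟨i + 1, by omega⟩}.ncard

/-- F_m⁽¹⁾: the number of q-ary strings of length m containing no index i with
α_i ≤ α_{i+1} ≤ α_{i+2}. -/
noncomputable def F1 (q m : ℕ) : ℕ :=
  {α : Fin m → Fin q | ¬ ∃ i : ℕ, ∃ h : i + 2 < m,
    α ⟨i, by omega⟩ ≤ α ⟨i + 1, by omega⟩ ∧ α ⟨i + 1, by omega⟩ ≤ α ⟨i + 2, h⟩}.ncard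

/-- Strings of length `m` over `Fin q` with no two consecutive strict descents. -/
def noDoubleDescent (q m : ℕ) : Set (Fin m → Fin q) :=
  {α | ¬ ∃ i : ℕ, ∃ h : i + 2 < m,
    α ⟨i + 1, by omega⟩ < α ⟨i, by omega⟩ ∧ α ⟨i + 2, h⟩ < α ⟨i + 1, by omega⟩}

theorem F0_eq_ncard (q m : ℕ) : F0 q m = (noDoubleDescent q m).ncard := rfl

theorem F1_lt_F0 (q m : ℕ) (hq : 0 < q) (hm : 3 ≤ m) : F1 q m < F0 q m := by
  have : NeZero q := ⟨hq.ne'⟩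
  rw [F0_eq_ncard, F1]
  have hinj : Function.Injective (fun (α : Fin m → Fin q) i => (α i).rev) := by
    intro α β h
    funext i
    exact Fin.rev_injective (congrFun h i)
  rw [← Set.ncard_image_of_injective _ hinj]
  apply Set.ncard_lt_ncard _ (Set.toFinite _)
  refine (Set.ssubset_iff_of_subset ?_).2 ⟨fun _ => 0, ?_, ?_⟩
  · rintro _ ⟨α, hα, rfl⟩ ⟨i, h, h₁, h₂⟩
    exact hα ⟨i, h, (Fin.rev_lt_rev.1 h₁).le, (Fin.rev_lt_rev.1 h₂).le⟩
  · rintro ⟨i, h, h₁, -⟩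
    exact lt_irrefl _ h₁
  · rintro ⟨α, hα, h⟩
    refine hα ⟨0, by omega, ?_, ?_⟩
    · exact (Fin.rev_injective ((congrFun h _).trans (congrFun h _).symm)).le
    · exact (Fin.rev_injective ((congrFun h _).trans (congrFun h _).symm)).le

theorem F0_le_pow (q m : ℕ) : F0 q m ≤ q ^ m := by
  simpa [F0_eq_ncard, Set.ncard_univ] using
    Set.ncard_le_ncard (Set.subset_univ (noDoubleDescent q m))

/-- A set of strings whose prefixes of length `n` and suffixes of length `k` have no double
descent has at most `F0 q n * F0 q k` elements. -/
theorem ncard_le_F0_mul_F0 (q n k : ℕ) (s : Set (Fin (n + k) → Fin q))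
    (hn : ∀ α ∈ s, (fun i => α (Fin.castAdd k i)) ∈ noDoubleDescent q n)
    (hk : ∀ α ∈ s, (fun i => α (Fin.natAdd n i)) ∈ noDoubleDescent q k) :
    s.ncard ≤ F0 q n * F0 q k := by
  rw [F0_eq_ncard, F0_eq_ncard, ← Set.ncard_prod]
  refine Set.ncard_le_ncard_of_injOn
    (fun α => (fun i => α (Fin.castAdd k i), fun i => α (Fin.natAdd n i)))
    (fun α hα => ⟨hn α hα, hk α hα⟩) ?_ (Set.toFinite _)
  intro α _ β _ h
  funext i
  rw [Prod.mk.injEq] at h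
  exact Fin.addCases (fun i => congrFun h.1 i) (fun i => congrFun h.2 i) i

theorem comp_castAdd_mem_noDoubleDescent {q n k : ℕ} {α : Fin (n + k) → Fin q}
    (hα : α ∈ noDoubleDescent q (n + k)) :
    (fun i => α (Fin.castAdd k i)) ∈ noDoubleDescent q n := by
  rintro ⟨i, h, h₁, h₂⟩
  exact hα ⟨i, by omega, h₁, h₂⟩

theorem comp_natAdd_mem_noDoubleDescent {q n k : ℕ} {α : Fin (n + k) → Fin q}
    (hα : α ∈ noDoubleDescent q (n + k)) :
    (fun i => α (Fin.natAdd n i)) ∈ noDoubleDescent q k := by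
  rintro ⟨i, h, h₁, h₂⟩
  exact hα ⟨n + i, by omega, h₁, h₂⟩

theorem F0_add_le (q n k : ℕ) : F0 q (n + k) ≤ F0 q n * F0 q k :=
  ncard_le_F0_mul_F0 q n k _ (fun _ => comp_castAdd_mem_noDoubleDescent)
    (fun _ => comp_natAdd_mem_noDoubleDescent)

theorem F0_succ_le (q n : ℕ) : F0 q (n + 1) ≤ F0 q n * q :=
  (F0_add_le q n 1).trans (Nat.mul_le_mul_left _ (by simpa using F0_le_pow q 1))

theorem sum_range_id_real (n : ℕ) : ∑ b ∈ Finset.range n, (b : ℝ) = n * (n - 1) / 2 := by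
  induction n with
  | zero => simp
  | succ n ih => rw [Finset.sum_range_succ, ih]; push_cast; ring

/-- Strictly decreasing triples, coded with dependent bounds. -/
abbrev DecTriple (q : ℕ) : Type := Σ a : Fin q, Σ b : Fin a, Fin b

theorem card_decTriple (q : ℕ) :
    (Fintype.card (DecTriple q) : ℝ) = q * (q - 1) * (q - 2) / 6 := by
  simp only [Fintype.card_sigma, Fintype.card_fin]
  push_cast
  simp only [Fin.sum_univ_eq_sum_range (fun b => (b : ℝ)), sum_range_id_real]
  rw [Fin.sum_univ_eq_sum_range (fun a => (a : ℝ) * (a - 1) / 2)]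
  induction q with
  | zero => simp
  | succ n ih => rw [Finset.sum_range_succ, ih]; push_cast; ring

/-- Quadruples `c ≤ a`, `a > b > d`, coded with dependent bounds. -/
abbrev PeakQuadruple (q : ℕ) : Type := Σ a : Fin q, Fin (a + 1) × Σ b : Fin a, Fin b

theorem card_peakQuadruple (q : ℕ) :
    (Fintype.card (PeakQuadruple q) : ℝ) = (q + 1) * q * (q - 1) * (q - 2) / 8 := by
  simp only [Fintype.card_sigma, Fintype.card_prod, Fintype.card_fin]
  push_cast
  simp only [Fin.sum_univ_eq_sum_range (fun b => (b : ℝ)), sum_range_id_real]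
  rw [Fin.sum_univ_eq_sum_range (fun a => ((a : ℝ) + 1) * (a * (a - 1) / 2))]
  induction q with
  | zero => simp
  | succ n ih => rw [Finset.sum_range_succ, ih]; push_cast; ring

/-- The string of a strictly decreasing triple. -/
def DecTriple.word {q : ℕ} (t : DecTriple q) : Fin 3 → Fin q :=
  ![t.1, ⟨t.2.1, t.2.1.2.trans t.1.2⟩, ⟨t.2.2, t.2.2.2.trans (t.2.1.2.trans t.1.2)⟩]

theorem DecTriple.word_injective (q : ℕ) :
    Function.Injective (DecTriple.word (q := q)) := by
  rintro ⟨a, b, c⟩ ⟨a', b', c'⟩ h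
  have h₀ := congrFun h 0
  have h₁ := congrFun h 1
  have h₂ := congrFun h 2
  simp only [DecTriple.word, Matrix.cons_val] at h₀ h₁ h₂
  subst h₀
  obtain rfl : b = b' := Fin.ext (Fin.mk.inj h₁)
  obtain rfl : c = c' := Fin.ext (Fin.mk.inj h₂)
  rfl

/-- The string `c, a, b, d` of a quadruple with `c ≤ a > b > d`. -/
def PeakQuadruple.word {q : ℕ} (t : PeakQuadruple q) : Fin 4 → Fin q :=
  ![⟨t.2.1, by omega⟩, t.1, ⟨t.2.2.1, t.2.2.1.2.trans t.1.2⟩,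
    ⟨t.2.2.2, t.2.2.2.2.trans (t.2.2.1.2.trans t.1.2)⟩]

theorem PeakQuadruple.word_injective (q : ℕ) :
    Function.Injective (PeakQuadruple.word (q := q)) := by
  rintro ⟨a, c, b, d⟩ ⟨a', c', b', d'⟩ h
  have h₀ := congrFun h 0
  have h₁ := congrFun h 1
  have h₂ := congrFun h 2
  have h₃ := congrFun h 3
  simp only [PeakQuadruple.word, Matrix.cons_val] at h₀ h₁ h₂ h₃
  subst h₁
  obtain rfl : b = b' := Fin.ext (Fin.mk.inj h₂)
  obtain rfl : c = c' := Fin.ext (Fin.mk.inj h₀)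
  obtain rfl : d = d' := Fin.ext (Fin.mk.inj h₃)
  rfl

theorem F0_three_add_card_le (q : ℕ) : F0 q 3 + Fintype.card (DecTriple q) ≤ q ^ 3 := by
  have hcard : (Set.range (DecTriple.word (q := q))).ncard = Fintype.card (DecTriple q) := by
    rw [← Set.image_univ, Set.ncard_image_of_injective _ (DecTriple.word_injective q),
      Set.ncard_univ, Nat.card_eq_fintype_card]
  have hdisj : Disjoint (noDoubleDescent q 3) (Set.range (DecTriple.word (q := q))) := by
    rw [Set.disjoint_left]
    rintro _ hα ⟨t, rfl⟩
    exact hα ⟨0, Nat.lt_succ_self 2, Fin.lt_def.2 t.2.1.2, Fin.lt_def.2 t.2.2.2⟩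
  rw [F0_eq_ncard, ← hcard, ← Set.ncard_union_eq hdisj]
  simpa [Set.ncard_univ] using Set.ncard_le_ncard
    (Set.subset_univ (noDoubleDescent q 3 ∪ Set.range (DecTriple.word (q := q))))

theorem F0_four_add_card_le (q : ℕ) :
    F0 q 4 + Fintype.card (PeakQuadruple q) ≤ F0 q 3 * q := by
  have hcard : (Set.range (PeakQuadruple.word (q := q))).ncard =
      Fintype.card (PeakQuadruple q) := by
    rw [← Set.image_univ, Set.ncard_image_of_injective _ (PeakQuadruple.word_injective q),
      Set.ncard_univ, Nat.card_eq_fintype_card]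
  have hdisj : Disjoint (noDoubleDescent q 4) (Set.range (PeakQuadruple.word (q := q))) := by
    rw [Set.disjoint_left]
    rintro _ hα ⟨t, rfl⟩
    exact hα ⟨1, Nat.lt_succ_self 3, Fin.lt_def.2 t.2.2.1.2, Fin.lt_def.2 t.2.2.2.2⟩
  rw [F0_eq_ncard, ← hcard, ← Set.ncard_union_eq hdisj]
  refine (ncard_le_F0_mul_F0 q 3 1 _ ?_ ?_).trans
    (Nat.mul_le_mul_left _ (by simpa using F0_le_pow q 1))
  · rintro _ (hα | ⟨t, rfl⟩)
    · exact comp_castAdd_mem_noDoubleDescent hα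
    · rintro ⟨i, h, h₁, -⟩
      obtain rfl : i = 0 := by omega
      exact (Nat.lt_succ_iff.1 t.2.1.2).not_gt (Fin.lt_def.1 h₁)
  · rintro α - ⟨i, h, -⟩
    omega

theorem F0_three_lt (q : ℕ) (hq : 2 < q) : (F0 q 3 : ℝ) < (0.99 * (q : ℝ)) ^ 3 := by
  have h : (F0 q 3 : ℝ) + Fintype.card (DecTriple q) ≤ (q : ℝ) ^ 3 := by
    exact_mod_cast F0_three_add_card_le q
  rw [card_decTriple] at h
  have hq' : (3 : ℝ) ≤ q := by exact_mod_cast hq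
  have hsq : 2 / 9 * (q : ℝ) ^ 2 ≤ (q - 1) * (q - 2) := by nlinarith
  have hpos : (0 : ℝ) < (q : ℝ) ^ 3 := by positivity
  nlinarith [mul_le_mul_of_nonneg_left hsq (by positivity : (0 : ℝ) ≤ q)]

theorem F0_four_le (q : ℕ) (hq : 2 < q) : (F0 q 4 : ℝ) ≤ 0.95 * (q : ℝ) ^ 4 := by
  have h₃ : (F0 q 3 : ℝ) + Fintype.card (DecTriple q) ≤ (q : ℝ) ^ 3 := by
    exact_mod_cast F0_three_add_card_le q
  have h₄ : (F0 q 4 : ℝ) + Fintype.card (PeakQuadruple q) ≤ F0 q 3 * q := by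
    exact_mod_cast F0_four_add_card_le q
  rw [card_decTriple] at h₃
  rw [card_peakQuadruple] at h₄
  have hq' : (3 : ℝ) ≤ q := by exact_mod_cast hq
  have hsq : 2 / 9 * (q : ℝ) ^ 2 ≤ (q - 1) * (q - 2) := by nlinarith
  have hpos : (0 : ℝ) < (q : ℝ) ^ 3 := by positivity
  have hpos' : (0 : ℝ) < (q : ℝ) ^ 4 := by positivity
  nlinarith [mul_le_mul_of_nonneg_left hsq (by positivity : (0 : ℝ) ≤ (q : ℝ) ^ 2),
    mul_le_mul_of_nonneg_left hsq (by positivity : (0 : ℝ) ≤ q),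
    mul_le_mul_of_nonneg_right h₃ (by positivity : (0 : ℝ) ≤ q)]

theorem F0_lt (q : ℕ) (hq : 2 < q) : ∀ n : ℕ, (F0 q (n + 3) : ℝ) < (0.99 * (q : ℝ)) ^ (n + 3)
  | 0 => F0_three_lt q hq
  | 1 => by
    have hpos : (0 : ℝ) < (q : ℝ) ^ 4 := by positivity
    refine (F0_four_le q hq).trans_lt ?_
    norm_num [mul_pow]
    linarith
  | 2 => by
    have hpos : (0 : ℝ) < (q : ℝ) ^ 5 := by positivity
    have h : (F0 q 5 : ℝ) ≤ F0 q 4 * q := by exact_mod_cast F0_succ_le q 4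
    have h' := mul_le_mul_of_nonneg_right (F0_four_le q hq) (by positivity : (0 : ℝ) ≤ q)
    norm_num [mul_pow]
    linarith [pow_succ (q : ℝ) 4]
  | n + 3 => by
    have h : (F0 q (n + 3 + 3) : ℝ) ≤ F0 q (n + 3) * F0 q 3 := by
      exact_mod_cast F0_add_le q (n + 3) 3
    rw [pow_add _ (n + 3)]
    exact h.trans_lt (mul_lt_mul'' (F0_lt q hq n) (F0_three_lt q hq) (by positivity)
      (by positivity))

/-- for q > 2 and m ≥ 3, F_m⁽¹⁾ < F_m⁽⁰⁾ < (0.99q)^m. -/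
theorem stmt9 (q m : ℕ) (hq : 2 < q) (hm : 3 ≤ m) :
    F1 q m < F0 q m ∧ (F0 q m : ℝ) < (0.99 * (q : ℝ)) ^ m := by
  refine ⟨F1_lt_F0 q m (by omega) hm, ?_⟩
  obtain ⟨n, rfl⟩ := Nat.exists_eq_add_of_le' hm
  exact F0_lt q hq n
end

section
/- For every integer q ≥ 1, the number F_5^(0) of strings α ∈ Σ_q^5 containing no index i with α_i > α_{i+1} > α_{i+2} equals q⁵ − 3q²·C(q,3) + 2q·C(q,4), where C(q,k) denotes the binomial coefficient q choose k. -/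
/-- The integer indicator of a strict descent from `a` to `b`. -/
def descent {q : ℕ} (a b : Fin q) : ℤ := if b < a then 1 else 0

lemma sum_range_choose_eq (n k : ℕ) :
    ∑ i ∈ Finset.range n, (i.choose k : ℤ) = n.choose (k + 1) := by
  induction n with
  | zero => simp
  | succ n ih => rw [Finset.sum_range_succ, ih, Nat.choose_succ_succ]; push_cast; ring

lemma sum_descent_mul_choose {q : ℕ} (a : Fin q) (k : ℕ) :
    ∑ b : Fin q, descent a b * ((b : ℕ).choose k : ℤ) = ((a : ℕ).choose (k + 1) : ℤ) := by
  have h := Finset.sum_range (n := q) fun i => if i < (a : ℕ) then (i.choose k : ℤ) else 0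
  simp only [descent, ite_mul, one_mul, zero_mul, Fin.lt_def]
  rw [← h, ← Finset.sum_filter, ← sum_range_choose_eq]
  congr 1
  ext i
  simp only [Finset.mem_filter, Finset.mem_range]
  omega

lemma sum_descent {q : ℕ} (a : Fin q) :
    ∑ b : Fin q, descent a b = ((a : ℕ).choose 1 : ℤ) := by
  simpa using sum_descent_mul_choose a 0

lemma sum_fin_choose (q k : ℕ) :
    ∑ a : Fin q, ((a : ℕ).choose k : ℤ) = q.choose (k + 1) := by
  rw [← sum_range_choose_eq, Finset.sum_range]

/-- Strings of length five as nested tuples. -/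
def tupleEquivString (A : Type*) : A × A × A × A × A ≃ (Fin 5 → A) where
  toFun x := ![x.1, x.2.1, x.2.2.1, x.2.2.2.1, x.2.2.2.2]
  invFun α := (α 0, α 1, α 2, α 3, α 4)
  left_inv _ := rfl
  right_inv α := by ext i; fin_cases i <;> rfl

lemma no_double_descent_iff {q : ℕ} (α : Fin 5 → Fin q) :
    (¬ ∃ i : ℕ, ∃ h : i + 2 < 5,
      α ⟨i + 1, by omega⟩ < α ⟨i, by omega⟩ ∧ α ⟨i + 2, h⟩ < α ⟨i + 1, by omega⟩) ↔
    ¬ (α 1 < α 0 ∧ α 2 < α 1) ∧ ¬ (α 2 < α 1 ∧ α 3 < α 2) ∧ ¬ (α 3 < α 2 ∧ α 4 < α 3) := by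
  constructor
  · intro h
    exact ⟨fun h' => h ⟨0, by omega, h'⟩, fun h' => h ⟨1, by omega, h'⟩,
      fun h' => h ⟨2, by omega, h'⟩⟩
  · rintro ⟨h0, h1, h2⟩ ⟨i, hi, h⟩
    obtain rfl | rfl | rfl : i = 0 ∨ i = 1 ∨ i = 2 := by omega
    exacts [h0 h, h1 h, h2 h]

/-- Inclusion–exclusion over the three positions of a double descent; the terms for the outer two
positions and for all three positions cancel. -/
lemma F0_five_eq_sum (q : ℕ) :
    (F0 q 5 : ℤ) = ∑ a : Fin q, ∑ b : Fin q, ∑ c : Fin q, ∑ d : Fin q, ∑ e : Fin q,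
      (1 - descent a b * descent b c - descent b c * descent c d - descent c d * descent d e
        + descent a b * (descent b c * descent c d)
        + descent b c * (descent c d * descent d e)) := by
  classical
  unfold F0
  simp only [no_double_descent_iff]
  rw [Set.ncard_eq_toFinset_card', Set.toFinset_ofPred, Finset.card_filter, Nat.cast_sum,
    ← (tupleEquivString (Fin q)).sum_comp]
  simp only [Fintype.sum_prod_type]
  refine Finset.sum_congr rfl fun a _ => Finset.sum_congr rfl fun b _ =>
    Finset.sum_congr rfl fun c _ => Finset.sum_congr rfl fun d _ =>
    Finset.sum_congr rfl fun e _ => ?_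
  change ((if ¬ (b < a ∧ c < b) ∧ ¬ (c < b ∧ d < c) ∧ ¬ (d < c ∧ e < d) then 1 else 0 : ℕ) : ℤ) = _
  unfold descent
  by_cases h1 : b < a <;> by_cases h2 : c < b <;> by_cases h3 : d < c <;> by_cases h4 : e < d <;>
    simp [h1, h2, h3, h4]

/-- F_5⁽⁰⁾ = q⁵ − 3q²·C(q,3) + 2q·C(q,4). -/
theorem stmt12 (q : ℕ) (hq : 1 ≤ q) :
    (F0 q 5 : ℤ) = (q : ℤ) ^ 5 - 3 * (q : ℤ) ^ 2 * (Nat.choose q 3 : ℤ)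
      + 2 * (q : ℤ) * (Nat.choose q 4 : ℤ) := by
  rw [F0_five_eq_sum]
  simp only [Finset.sum_add_distrib, Finset.sum_sub_distrib, Finset.sum_const, Finset.card_univ,
    Fintype.card_fin, nsmul_eq_mul, ← Finset.mul_sum, sum_descent, sum_descent_mul_choose,
    sum_fin_choose, mul_left_comm _ (q : ℤ)]
  ring
end

section
/- There exists a positive integer d₀ such that for every integer d ≥ d₀ and every integer q > 2, there exists N such that for all n ≥ N, the number of d-regular q-ary strings of length n is strictly greater than q^{n−1}. In particular, for sufficiently large n there exists an injective map from Σ_q^{n−1} into the set R_n of d-regular strings in Σ_q^n. -/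
/-- A binary string is d-regular if every contiguous substring of length at least
d·log₂ n contains both 00 and 11 as contiguous substrings. -/
def dRegularBin {n : ℕ} (d : ℕ) (a : Fin n → Fin 2) : Prop :=
  ∀ (i L : ℕ), ∀ _hiL : i + L ≤ n, (d : ℝ) * Real.logb 2 n ≤ (L : ℝ) →
    (∃ k : ℕ, ∃ _h2 : k + 2 ≤ i + L, i ≤ k ∧
      a ⟨k, by omega⟩ = 0 ∧ a ⟨k + 1, by omega⟩ = 0) ∧
    (∃ k : ℕ, ∃ _h2 : k + 2 ≤ i + L, i ≤ k ∧
      a ⟨k, by omega⟩ = 1 ∧ a ⟨k + 1, by omega⟩ = 1)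

/-- A q-ary string is d-regular if its associated binary string φ(α) is d-regular. -/
def dRegular {q n : ℕ} (d : ℕ) (α : Fin n → Fin q) : Prop := dRegularBin d (phi α)

/-- The number of strings avoiding a predicate on `m` disjoint triples of positions. -/
lemma card_avoiding_triples_le {ι X : Type*} [Fintype ι] [Fintype X] {m : ℕ}
    (e : Fin m × Fin 3 → ι) (he : Function.Injective e) (P : X × X × X → Prop) :
    Nat.card {α : ι → X // ∀ j, ¬ P (α (e (j, 0)), α (e (j, 1)), α (e (j, 2)))} ≤
      Nat.card {p // ¬ P p} ^ m * Nat.card X ^ (Nat.card ι - 3 * m) := by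
  classical
  have hcompl : Nat.card {x // x ∉ Set.range e} = Nat.card ι - 3 * m := by
    rw [Nat.card_eq_fintype_card, Fintype.card_subtype_compl, Nat.card_eq_fintype_card,
      Fintype.card_of_bijective (f := Equiv.ofInjective e he |>.symm) (Equiv.bijective _)]
    simp [mul_comm]
  let F : {α : ι → X // ∀ j, ¬ P (α (e (j, 0)), α (e (j, 1)), α (e (j, 2)))} →
      (Fin m → {p // ¬ P p}) × ({x // x ∉ Set.range e} → X) :=
    fun α => (fun j => ⟨_, α.2 j⟩, fun x => α.1 x)
  have hF : Function.Injective F := by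
    rintro ⟨α, hα⟩ ⟨β, hβ⟩ h
    obtain ⟨h₁, h₂⟩ := Prod.mk.inj h
    refine Subtype.ext (funext fun x => ?_)
    by_cases hx : x ∈ Set.range e
    · obtain ⟨⟨j, c⟩, rfl⟩ := hx
      have hj := congrArg Subtype.val (congrFun h₁ j)
      simp only [Prod.mk.injEq] at hj
      fin_cases c
      exacts [hj.1, hj.2.1, hj.2.2]
    · exact congrFun h₂ ⟨x, hx⟩
  refine (Nat.card_le_card_of_injective F hF).trans_eq ?_
  rw [Nat.card_prod, Nat.card_fun, Nat.card_fun, hcompl, Nat.card_fin]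

/-- If `P` holds on an injective image of `(Fin t)³` with `q ≤ 5 t`, then it fails on at most a
`124 / 125` fraction of all triples. -/
lemma card_triples_not_le {q t : ℕ} (ht : q ≤ 5 * t) (P : Fin q × Fin q × Fin q → Prop)
    (g : Fin t × Fin t × Fin t → Fin q × Fin q × Fin q) (hg : Function.Injective g)
    (hP : ∀ x, P (g x)) : 125 * Nat.card {p // ¬ P p} ≤ 124 * q ^ 3 := by
  classical
  have hgood : t ^ 3 ≤ Nat.card {p // P p} := by
    have := Nat.card_le_card_of_injective (fun x => (⟨g x, hP x⟩ : {p // P p}))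
      (fun x y h => hg (congrArg Subtype.val h))
    simp only [Nat.card_prod, Nat.card_fin] at this
    linarith [show t * (t * t) = t ^ 3 by ring]
  have hsum : Nat.card {p // P p} + Nat.card {p // ¬ P p} = q ^ 3 := by
    rw [← Nat.card_sum, Nat.card_congr (Equiv.sumCompl P)]
    simp only [Nat.card_prod, Nat.card_fin]
    ring
  have hq : q ^ 3 ≤ 125 * t ^ 3 := by
    calc q ^ 3 ≤ (5 * t) ^ 3 := Nat.pow_le_pow_left ht 3
      _ = 125 * t ^ 3 := by ring
  omega

lemma card_not_descending_le {q : ℕ} (hq : 2 < q) :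
    125 * Nat.card {p : Fin q × Fin q × Fin q // ¬ (p.2.1 < p.1 ∧ p.2.2 < p.2.1)} ≤
      124 * q ^ 3 := by
  refine card_triples_not_le (t := q / 3) (by omega) _
    (fun x => (⟨2 * (q / 3) + x.1, by omega⟩, ⟨q / 3 + x.2.1, by omega⟩, ⟨x.2.2, by omega⟩))
    ?_ ?_
  · rintro ⟨a, b, c⟩ ⟨a', b', c'⟩ h
    simp only [Prod.mk.injEq, Fin.ext_iff] at h ⊢
    omega
  · rintro ⟨a, b, c⟩
    simp only [Fin.mk_lt_mk]
    omega

lemma card_not_ascending_le {q : ℕ} (hq : 2 < q) :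
    125 * Nat.card {p : Fin q × Fin q × Fin q // ¬ (p.1 ≤ p.2.1 ∧ p.2.1 ≤ p.2.2)} ≤
      124 * q ^ 3 := by
  refine card_triples_not_le (t := q / 3) (by omega) _
    (fun x => (⟨x.1, by omega⟩, ⟨q / 3 + x.2.1, by omega⟩, ⟨2 * (q / 3) + x.2.2, by omega⟩))
    ?_ ?_
  · rintro ⟨a, b, c⟩ ⟨a', b', c'⟩ h
    simp only [Prod.mk.injEq, Fin.ext_iff] at h ⊢
    omega
  · rintro ⟨a, b, c⟩
    simp only [Fin.mk_le_mk]
    omega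

/-- The strings of length `n` for which `P` fails on each of the `m` consecutive triples of
positions starting at `i`. -/
def avoiding {q : ℕ} (P : Fin q × Fin q × Fin q → Prop) (n i m : ℕ) : Set (Fin n → Fin q) :=
  {α | ∃ _ : i + 3 * m ≤ n, ∀ j : Fin m, ¬ P (α ⟨i + 3 * j, by omega⟩,
    α ⟨i + 3 * j + 1, by omega⟩, α ⟨i + 3 * j + 2, by omega⟩)}

lemma ncard_avoiding_le {q : ℕ} (P : Fin q × Fin q × Fin q → Prop)
    (hP : 125 * Nat.card {p // ¬ P p} ≤ 124 * q ^ 3) (n i k : ℕ) :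
    2 ^ (4 * k) * (avoiding P n i (400 * k)).ncard ≤ q ^ n := by
  by_cases h : i + 3 * (400 * k) ≤ n
  swap
  · simp [avoiding, h]
  have hcount : (avoiding P n i (400 * k)).ncard ≤
      Nat.card {p // ¬ P p} ^ (400 * k) * q ^ (n - 3 * (400 * k)) := by
    have := card_avoiding_triples_le (ι := Fin n) (m := 400 * k)
      (fun p => ⟨i + 3 * p.1 + p.2, by omega⟩) (by
        rintro ⟨a, b⟩ ⟨a', b'⟩ hab
        simp only [Prod.mk.injEq, Fin.ext_iff] at hab ⊢
        omega) P
    rw [Nat.card_fin, Nat.card_fin] at this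
    refine le_trans (le_of_eq ?_) this
    rw [← Nat.card_coe_set_eq]
    refine Nat.card_congr (Equiv.subtypeEquivRight fun α => ?_)
    simp [avoiding, h]
  have hnum : 2 ^ (4 * k) * 124 ^ (400 * k) ≤ 125 ^ (400 * k) := by
    have : 2 * 124 ^ 100 ≤ 125 ^ 100 := by norm_num
    have := Nat.pow_le_pow_left this (4 * k)
    rwa [mul_pow, ← pow_mul, ← pow_mul, show 100 * (4 * k) = 400 * k by ring] at this
  have hbad : 125 ^ (400 * k) * Nat.card {p // ¬ P p} ^ (400 * k) ≤
      124 ^ (400 * k) * q ^ (3 * (400 * k)) := by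
    simpa only [mul_pow, ← pow_mul] using Nat.pow_le_pow_left hP (400 * k)
  refine le_of_mul_le_mul_left ?_ (Nat.pow_pos (by norm_num) : 0 < 124 ^ (400 * k))
  calc 124 ^ (400 * k) * (2 ^ (4 * k) * (avoiding P n i (400 * k)).ncard)
      = (2 ^ (4 * k) * 124 ^ (400 * k)) * (avoiding P n i (400 * k)).ncard := by ac_rfl
    _ ≤ 125 ^ (400 * k) * (Nat.card {p // ¬ P p} ^ (400 * k) * q ^ (n - 3 * (400 * k))) :=
        Nat.mul_le_mul hnum hcount
    _ = 125 ^ (400 * k) * Nat.card {p // ¬ P p} ^ (400 * k) * q ^ (n - 3 * (400 * k)) := by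
        rw [mul_assoc]
    _ ≤ 124 ^ (400 * k) * q ^ (3 * (400 * k)) * q ^ (n - 3 * (400 * k)) :=
        Nat.mul_le_mul_right _ hbad
    _ = 124 ^ (400 * k) * q ^ n := by
        rw [mul_assoc, ← pow_add, Nat.add_sub_cancel' (by omega)]

/-- A string that is not regular avoids descending or ascending triples on a long window. -/
lemma exists_mem_avoiding_of_not_dRegular {q n d : ℕ} (hn : 2 ≤ n) (hd : 1200 ≤ d)
    {α : Fin n → Fin q} (h : ¬ dRegular d α) :
    ∃ i < n, α ∈ avoiding (fun p => p.2.1 < p.1 ∧ p.2.2 < p.2.1) n i (400 * Nat.log 2 n) ∪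
      avoiding (fun p => p.1 ≤ p.2.1 ∧ p.2.1 ≤ p.2.2) n i (400 * Nat.log 2 n) := by
  contrapose! h
  intro i L hiL hL
  have hk : 0 < Nat.log 2 n := Nat.log_pos (by norm_num) hn
  have hlen : 1200 * Nat.log 2 n ≤ L := by
    have hlog : (Nat.log 2 n : ℝ) ≤ Real.logb 2 n := by
      exact_mod_cast Real.natLog_le_logb n 2
    have hd' : (1200 : ℝ) ≤ d := by exact_mod_cast hd
    have : (1200 : ℝ) * Nat.log 2 n ≤ L :=
      (mul_le_mul hd' hlog (by positivity) (by positivity)).trans hL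
    exact_mod_cast this
  have hi := h i (by omega)
  have hwin : i + 3 * (400 * Nat.log 2 n) ≤ n := by omega
  simp only [Set.mem_union, not_or, avoiding, Set.mem_ofPred_eq, not_exists, not_forall,
    not_not] at hi
  obtain ⟨⟨j, hj₁, hj₂⟩, ⟨j', hj₁', hj₂'⟩⟩ := And.intro (hi.1 hwin) (hi.2 hwin)
  refine ⟨⟨i + 3 * j + 1, by omega, by omega, ?_, ?_⟩,
    ⟨i + 3 * j' + 1, by omega, by omega, ?_, ?_⟩⟩
  · simpa [phi] using hj₁
  · simpa [phi] using hj₂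
  · simpa [phi] using hj₁'
  · simpa [phi] using hj₂'

/-- At least half of all strings are regular. -/
lemma two_mul_ncard_not_dRegular_le {q n d : ℕ} (hq : 2 < q) (hn : 2 ≤ n) (hd : 1200 ≤ d) :
    2 * {α : Fin n → Fin q | ¬ dRegular d α}.ncard ≤ q ^ n := by
  set k := Nat.log 2 n
  have hk0 : 0 < k := Nat.log_pos (by norm_num) hn
  let U : ℕ → Set (Fin n → Fin q) := fun i =>
    avoiding (fun p => p.2.1 < p.1 ∧ p.2.2 < p.2.1) n i (400 * k) ∪
      avoiding (fun p => p.1 ≤ p.2.1 ∧ p.2.1 ≤ p.2.2) n i (400 * k)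
  have hU (i : ℕ) : 2 ^ (4 * k) * (U i).ncard ≤ 2 * q ^ n := by
    have h₁ := ncard_avoiding_le _ (card_not_descending_le hq) n i k
    have h₂ := ncard_avoiding_le _ (card_not_ascending_le hq) n i k
    have := Nat.mul_le_mul_left (2 ^ (4 * k)) (Set.ncard_union_le
      (avoiding (fun p : Fin q × Fin q × Fin q => p.2.1 < p.1 ∧ p.2.2 < p.2.1) n i (400 * k))
      (avoiding (fun p => p.1 ≤ p.2.1 ∧ p.2.1 ≤ p.2.2) n i (400 * k)))
    rw [mul_add] at this
    exact this.trans (by omega)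
  have hsub : {α : Fin n → Fin q | ¬ dRegular d α} ⊆ ⋃ i ∈ Finset.range n, U i := by
    intro α hα
    obtain ⟨i, hi, hαi⟩ := exists_mem_avoiding_of_not_dRegular hn hd hα
    exact Set.mem_biUnion (by simpa using hi) hαi
  have hle : {α : Fin n → Fin q | ¬ dRegular d α}.ncard ≤ ∑ i ∈ Finset.range n, (U i).ncard :=
    (Set.ncard_le_ncard hsub (Set.toFinite _)).trans (Finset.set_ncard_biUnion_le _ _)
  have hn_lt : n < 2 ^ (k + 1) := Nat.lt_pow_succ_log_self (by norm_num) n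
  have htotal : 2 ^ (4 * k) * {α : Fin n → Fin q | ¬ dRegular d α}.ncard ≤
      2 ^ (k + 1) * (2 * q ^ n) := by
    calc _ ≤ 2 ^ (4 * k) * ∑ i ∈ Finset.range n, (U i).ncard := Nat.mul_le_mul_left _ hle
      _ = ∑ i ∈ Finset.range n, 2 ^ (4 * k) * (U i).ncard := Finset.mul_sum _ _ _
      _ ≤ ∑ _i ∈ Finset.range n, 2 * q ^ n := Finset.sum_le_sum fun i _ => hU i
      _ = n * (2 * q ^ n) := by simp
      _ ≤ _ := Nat.mul_le_mul_right _ hn_lt.le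
  refine le_of_mul_le_mul_left ?_ (Nat.pow_pos (by norm_num) : 0 < 2 ^ (k + 2))
  calc _ = 2 ^ (k + 3) * {α : Fin n → Fin q | ¬ dRegular d α}.ncard := by ring
    _ ≤ 2 ^ (4 * k) * {α : Fin n → Fin q | ¬ dRegular d α}.ncard :=
        Nat.mul_le_mul_right _ (Nat.pow_le_pow_right (by norm_num) (by omega))
    _ ≤ 2 ^ (k + 1) * (2 * q ^ n) := htotal
    _ = 2 ^ (k + 2) * q ^ n := by ring

/-- for a sufficiently large regularity parameter d and any q > 2, for all
sufficiently large n the number of d-regular q-ary strings of length n exceeds q^{n−1};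
in particular there is an injection of Σ_q^{n−1} into the set of d-regular strings. -/
theorem stmt15 :
    ∃ d0 : ℕ, 0 < d0 ∧ ∀ d : ℕ, d0 ≤ d → ∀ q : ℕ, 2 < q →
      ∃ N : ℕ, ∀ n : ℕ, N ≤ n →
        q ^ (n - 1) < {α : Fin n → Fin q | dRegular d α}.ncard ∧
        ∃ f : (Fin (n - 1) → Fin q) → {α : Fin n → Fin q // dRegular d α},
          Function.Injective f := by
  classical
  refine ⟨1200, by norm_num, fun d hd q hq => ⟨2, fun n hn => ?_⟩⟩
  have hcard : q ^ (n - 1) < {α : Fin n → Fin q | dRegular d α}.ncard := by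
    have hbad := two_mul_ncard_not_dRegular_le hq hn hd
    have hsum := Set.ncard_add_ncard_compl {α : Fin n → Fin q | dRegular d α}
    rw [Set.compl_ofPred, Nat.card_fun, Nat.card_fin, Nat.card_fin] at hsum
    have hpow : q ^ n = q ^ (n - 1) * q := by rw [← pow_succ, Nat.sub_add_cancel (by omega)]
    have hpos : 0 < q ^ (n - 1) := by positivity
    have : q ^ (n - 1) * 3 ≤ q ^ (n - 1) * q := Nat.mul_le_mul_left _ hq
    omega
  refine ⟨hcard, ?_⟩
  have hle : Fintype.card (Fin (n - 1) → Fin q) ≤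
      Fintype.card {α : Fin n → Fin q // dRegular d α} := by
    rw [← Nat.card_eq_fintype_card, ← Nat.card_eq_fintype_card, Nat.card_fun, Nat.card_fin,
      Nat.card_fin]
    exact hcard.le
  obtain ⟨f⟩ := Function.Embedding.nonempty_of_card_le hle
  exact ⟨f, f.injective⟩
end

section
/- There exists a constant c > 0 such that for every odd prime q and every integer n ≥ 4, there exists a code C ⊆ Σ_q^n whose redundancy satisfies n·log₂ q − log₂ |C| ≤ 4·log₂ n + 10·log₂ log₂ n + 2·log₂ q + c, and which is list-decodable against 2 deletions with list size at most 2: for every y ∈ Σ_q^{n−2}, the set {x ∈ C : y is a subsequence of x} has at most 2 elements. -/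
/-- A strictly monotone map into `Fin (m + 1)` from a smaller `Fin k` misses a point, and hence
factors through `Fin.succAbove` at that point. -/
lemma exists_succAbove_comp_of_strictMono {k m : ℕ} (hk : k ≤ m) {f : Fin k → Fin (m + 1)}
    (hf : StrictMono f) :
    ∃ (p : Fin (m + 1)) (g : Fin k → Fin m), StrictMono g ∧ ∀ i, f i = p.succAbove (g i) := by
  have hns : ¬ Function.Surjective f := fun hs => by
    have := Fintype.card_le_of_surjective f hs
    simp only [Fintype.card_fin] at this
    omega
  obtain ⟨p, hp⟩ := not_forall.mp hns
  choose g hg using fun i => Fin.exists_succAbove_eq (x := f i) (y := p) fun h => hp ⟨i, h⟩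
  refine ⟨p, g, fun i j hij => ?_, fun i => (hg i).symm⟩
  rw [← (Fin.strictMono_succAbove p).lt_iff_lt, hg, hg]
  exact hf hij

/-- A subsequence two symbols shorter arises by removing two entries. -/
lemma Subseq.exists_removeNth {q m : ℕ} {y : Fin m → Fin q} {x : Fin (m + 2) → Fin q}
    (h : Subseq y x) :
    ∃ (p : Fin (m + 2)) (r : Fin (m + 1)), r.removeNth (p.removeNth x) = y := by
  obtain ⟨f, hf, hy⟩ := h
  obtain ⟨p, g, hg, hfg⟩ := exists_succAbove_comp_of_strictMono (by omega) hf
  obtain ⟨r, e, he, hge⟩ := exists_succAbove_comp_of_strictMono le_rfl hg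
  refine ⟨p, r, funext fun i => ?_⟩
  have he_id : e = id := (he.range_inj strictMono_id).mp (by
    rw [(Finite.surjective_of_injective he.injective).range_eq, Set.range_id])
  rw [hy, hfg, hge, he_id]
  rfl

/-- Greedy packing: if every object `y` related to `x` is one of the `del i x`, and every `x`
related to `y` is one of the `ins k y`, then a maximal set of points sharing no related object has
at least `card V / (card ι * card κ)` elements. -/
lemma exists_packing {V Y ι κ : Type*} [Fintype V] [Fintype ι] [Fintype κ]
    (S : Y → V → Prop) (del : ι → V → Y) (ins : κ → Y → V)
    (hdel : ∀ y x, S y x → ∃ i, del i x = y) (hins : ∀ y x, S y x → ∃ k, ins k y = x)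
    (hex : ∀ x, ∃ y, S y x) :
    ∃ C : Finset V, (∀ y, ∀ x ∈ C, ∀ x' ∈ C, S y x → S y x' → x = x') ∧
      Fintype.card V ≤ C.card * (Fintype.card ι * Fintype.card κ) := by
  classical
  let P : Finset V → Prop := fun C => ∀ y, ∀ x ∈ C, ∀ x' ∈ C, S y x → S y x' → x = x'
  obtain ⟨C, hC, hmax⟩ := (Finset.univ.filter P).exists_max_image Finset.card
    ⟨∅, by simp [P]⟩
  have hCP : P C := (Finset.mem_filter.mp hC).2
  refine ⟨C, hCP, ?_⟩
  have hcover : ∀ x, ∃ c ∈ C, ∃ y, S y c ∧ S y x := by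
    intro x
    by_contra! hx
    have hxC : x ∉ C := fun h => by
      obtain ⟨y, hy⟩ := hex x
      exact hx x h y hy hy
    have hPins : P (insert x C) := by
      intro y a ha b hb hya hyb
      rcases Finset.mem_insert.mp ha with rfl | ha' <;> rcases Finset.mem_insert.mp hb with rfl | hb'
      · rfl
      · exact (hx b hb' y hyb hya).elim
      · exact (hx a ha' y hya hyb).elim
      · exact hCP y a ha' b hb' hya hyb
    have := hmax _ (Finset.mem_filter.mpr ⟨Finset.mem_univ _, hPins⟩)
    rw [Finset.card_insert_of_notMem hxC] at this
    omega
  let F : C × ι × κ → V := fun t => ins t.2.2 (del t.2.1 t.1)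
  have hF : Function.Surjective F := fun x => by
    obtain ⟨c, hc, y, hyc, hyx⟩ := hcover x
    obtain ⟨i, rfl⟩ := hdel y c hyc
    obtain ⟨k, hk⟩ := hins _ x hyx
    exact ⟨(⟨c, hc⟩, i, k), hk⟩
  simpa using Fintype.card_le_of_surjective F hF

/-- A greedy code of length `m + 2` correcting two deletions. -/
lemma exists_two_deletion_code (q m : ℕ) :
    ∃ C : Finset (Fin (m + 2) → Fin q),
      (∀ y : Fin m → Fin q, ∀ x ∈ C, ∀ x' ∈ C, Subseq y x → Subseq y x' → x = x') ∧
      q ^ (m + 2) ≤ C.card * ((m + 2) ^ 4 * q ^ 2) := by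
  obtain ⟨C, hC, hcard⟩ := exists_packing
    (ι := Fin (m + 2) × Fin (m + 1)) (κ := (Fin (m + 2) × Fin (m + 1)) × (Fin q × Fin q))
    (fun (y : Fin m → Fin q) (x : Fin (m + 2) → Fin q) => Subseq y x)
    (fun t x => t.2.removeNth (t.1.removeNth x))
    (fun t y => Fin.insertNth (α := fun _ => Fin q) t.1.1 t.2.1
      (Fin.insertNth (α := fun _ => Fin q) t.1.2 t.2.2 y))
    (fun y x h => by
      obtain ⟨p, r, hpr⟩ := h.exists_removeNth
      exact ⟨(p, r), hpr⟩)
    (fun y x h => by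
      obtain ⟨p, r, rfl⟩ := h.exists_removeNth
      exact ⟨((p, r), (x p, p.removeNth x r)), by simp⟩)
    (fun x => ⟨fun i => x (Fin.castAdd 2 i), Fin.castAdd 2, Fin.strictMono_castAdd 2,
      fun _ => rfl⟩)
  refine ⟨C, hC, ?_⟩
  simp only [Fintype.card_pi, Finset.prod_const, Finset.card_univ, Fintype.card_fin,
    Fintype.card_prod] at hcard
  refine hcard.trans (Nat.mul_le_mul_left _ ?_)
  calc (m + 2) * (m + 1) * ((m + 2) * (m + 1) * (q * q))
      ≤ (m + 2) * (m + 2) * ((m + 2) * (m + 2) * (q * q)) := by gcongr <;> omega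
    _ = (m + 2) ^ 4 * q ^ 2 := by ring

/-- main theorem, list decoding: there is a q-ary code of length n with
redundancy at most 4log n + 10loglog n + 2log q + O(1) which is list-decodable against
2 deletions with list size at most 2. -/
theorem stmt17 :
    ∃ c : ℝ, 0 < c ∧ ∀ q n : ℕ, Nat.Prime q → q ≠ 2 → 4 ≤ n →
      ∃ C : Finset (Fin n → Fin q),
        (∀ y : Fin (n - 2) → Fin q,
          {x : Fin n → Fin q | x ∈ C ∧ Subseq y x}.ncard ≤ 2) ∧
        (n : ℝ) * Real.logb 2 q - Real.logb 2 C.card ≤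
          4 * Real.logb 2 n + 10 * Real.logb 2 (Real.logb 2 n)
            + 2 * Real.logb 2 q + c := by
  refine ⟨1, one_pos, fun q n hq _ hn => ?_⟩
  obtain ⟨m, rfl⟩ : ∃ m, n = m + 2 := ⟨n - 2, by omega⟩
  obtain ⟨C, hC, hcard⟩ := exists_two_deletion_code q m
  refine ⟨C, fun y => ?_, ?_⟩
  · refine le_trans ((Set.ncard_le_one (Set.toFinite _)).mpr ?_) one_le_two
    rintro a ⟨ha, hya⟩ b ⟨hb, hyb⟩
    exact hC y a ha b hb hya hyb
  have hq0 : (0 : ℝ) < q := by exact_mod_cast hq.pos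
  have hC0 : (0 : ℝ) < C.card := by
    have : C.card ≠ 0 := fun h => by
      rw [h, zero_mul] at hcard
      exact (pow_pos hq.pos (m + 2)).not_ge hcard
    exact_mod_cast Nat.pos_of_ne_zero this
  generalize m + 2 = n at *
  have hn0 : (0 : ℝ) < n := by
    have : 0 < n := by omega
    exact_mod_cast this
  have hlogn : 1 ≤ Real.logb 2 n := by
    rw [Real.le_logb_iff_rpow_le one_lt_two hn0]
    have : (4 : ℝ) ≤ n := by exact_mod_cast hn
    norm_num
    linarith
  have hloglog : 0 ≤ Real.logb 2 (Real.logb 2 n) := Real.logb_nonneg one_lt_two hlogn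
  have hlog : Real.logb 2 ((q : ℝ) ^ n) ≤ Real.logb 2 (C.card * ((n : ℝ) ^ 4 * (q : ℝ) ^ 2)) :=
    Real.logb_le_logb_of_le one_lt_two (by positivity) (by exact_mod_cast hcard)
  rw [Real.logb_mul (by positivity) (by positivity), Real.logb_mul (by positivity) (by positivity),
    Real.logb_pow, Real.logb_pow, Real.logb_pow] at hlog
  push_cast at hlog
  linarith
end
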